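/- arXiv:1905.06895 — 2 statements merged into one kernel-verified Lean document; each statement's English description precedes it below -/
import Mathlib

section
/- Let G be a 3-regular simple graph with n vertices and let v be a vertex of G. Let G' be the graph obtained from G by adding 2n new vertices a_1, b_1, ..., a_n, b_n and, for each i, the edges {v, a_i} and {a_i, b_i} (i.e., attaching n paths of length 2 to v). Then G has a Hamiltonian cycle if and only if G' can be transformed into an Eulerian graph by a sequence of at most n/2 1-switches. -/
open SimpleGraph Finset
open scoped Classical

/-- A simple graph is Eulerian if it is connected and every vertex has even degree. -/
def IsEulerianGraph {V : Type*} [Fintype V] (G : SimpleGraph V) : Prop :=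
  G.Connected ∧ ∀ v : V, Even (G.degree v)

/-- A `k`-switch on a simple graph `G`: remove `k` edges from `G` and add `k` edges, obtaining
a simple graph `G'` on the same vertex set with the same number of edges. -/
def IsKSwitch {V : Type*} [Fintype V] (k : ℕ) (G G' : SimpleGraph V) : Prop :=
  ∃ R A : Finset (Sym2 V), R.card = k ∧ A.card = k ∧ R ⊆ G.edgeFinset ∧
    G'.edgeFinset = (G.edgeFinset \ R) ∪ A ∧ G'.edgeFinset.card = G.edgeFinset.card

/-- The graph obtained from `G` by attaching `n` paths of length 2 to the vertex `v`:
for each `i : Fin n`, the new vertices are `aᵢ = Sum.inr (i, false)` and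
`bᵢ = Sum.inr (i, true)`, with edges `{v, aᵢ}` and `{aᵢ, bᵢ}`. -/
def attachPaths {V : Type*} (G : SimpleGraph V) (v : V) (n : ℕ) :
    SimpleGraph (V ⊕ (Fin n × Bool)) :=
  SimpleGraph.fromEdgeSet
    ((Sym2.map Sum.inl '' G.edgeSet) ∪
      {e | ∃ i : Fin n, e = s(Sum.inl v, Sum.inr (i, false))} ∪
      {e | ∃ i : Fin n, e = s(Sum.inr (i, false), Sum.inr (i, true))})


/-- The auxiliary graph: `H` on the base, all paths attached at `v`, and `B` on path ends. -/
def auxG {V : Type*} (H : SimpleGraph V) (v : V) (n : ℕ) (B : SimpleGraph (Fin n)) :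
    SimpleGraph (V ⊕ (Fin n × Bool)) where
  Adj x y := match x, y with
    | Sum.inl a, Sum.inl b => H.Adj a b
    | Sum.inl a, Sum.inr (_, false) => a = v
    | Sum.inl _, Sum.inr (_, true) => False
    | Sum.inr (_, false), Sum.inl a => a = v
    | Sum.inr (_, true), Sum.inl _ => False
    | Sum.inr (i, true), Sum.inr (j, true) => B.Adj i j
    | Sum.inr (i, true), Sum.inr (j, false) => i = j
    | Sum.inr (i, false), Sum.inr (j, true) => i = j
    | Sum.inr (_, false), Sum.inr (_, false) => False
  symm := ⟨by
    rintro (a | ⟨i, _ | _⟩) (b | ⟨j, _ | _⟩) h <;> simp_all [SimpleGraph.adj_comm]⟩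
  loopless := ⟨by
    rintro (a | ⟨i, _ | _⟩) h <;> simp_all⟩

lemma attach_eq_aux {V : Type*} (G : SimpleGraph V) (v : V) (n : ℕ) :
    attachPaths G v n = auxG G v n ⊥ := by
  ext x y
  have key : ∀ a b : V, (∃ e ∈ G.edgeSet, Sym2.map (Sum.inl : V → V ⊕ (Fin n × Bool)) e = s(Sum.inl a, Sum.inl b)) ↔ G.Adj a b := by
    intro a b
    constructor
    · rintro ⟨e, he, h⟩
      induction e with | _ c d =>
      simp at h he
      rcases h with ⟨rfl, rfl⟩ | ⟨rfl, rfl⟩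
      · exact he
      · exact he.symm
    · intro h
      exact ⟨s(a, b), h, by simp⟩
  have key2 : ∀ (a : V ⊕ (Fin n × Bool)) (q : Fin n × Bool), ¬ ∃ e ∈ G.edgeSet, Sym2.map (Sum.inl : V → V ⊕ (Fin n × Bool)) e = s(a, Sum.inr q) := by
    rintro a q ⟨e, he, h⟩
    induction e with | _ c d => simp at h
  have key3 : ∀ (a : V ⊕ (Fin n × Bool)) (q : Fin n × Bool), ¬ ∃ e ∈ G.edgeSet, Sym2.map (Sum.inl : V → V ⊕ (Fin n × Bool)) e = s(Sum.inr q, a) := by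
    rintro a q ⟨e, he, h⟩
    induction e with | _ c d => simp at h
  unfold attachPaths
  rw [SimpleGraph.fromEdgeSet_adj]
  simp only [Set.mem_union, Set.mem_image, Set.mem_ofPred_eq]
  rcases x with a | ⟨i, _ | _⟩ <;> rcases y with b | ⟨j, _ | _⟩ <;>
    simp only [key, key2, key3] <;> simp [auxG]
  · exact fun h => h.ne
  all_goals (constructor <;> intro h <;> simp_all)

lemma aux_deg_inl {V : Type*} [Fintype V] (H : SimpleGraph V) (v : V) (n : ℕ)
    (B : SimpleGraph (Fin n)) (w : V) :
    (auxG H v n B).degree (Sum.inl w) = H.degree w + if w = v then n else 0 := by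
  have : (auxG H v n B).neighborFinset (Sum.inl w) =
      (H.neighborFinset w).disjSum
        (if w = v then (Finset.univ : Finset (Fin n)) ×ˢ {false} else ∅) := by
    ext x
    rw [SimpleGraph.mem_neighborFinset]
    rcases x with a | ⟨i, _ | _⟩ <;> simp [auxG] <;> split_ifs <;> simp_all
  rw [← SimpleGraph.card_neighborFinset_eq_degree, this, Finset.card_disjSum,
    SimpleGraph.card_neighborFinset_eq_degree]
  split_ifs <;> simp

lemma aux_deg_a {V : Type*} [Fintype V] (H : SimpleGraph V) (v : V) (n : ℕ)
    (B : SimpleGraph (Fin n)) (i : Fin n) :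
    (auxG H v n B).degree (Sum.inr (i, false)) = 2 := by
  have : (auxG H v n B).neighborFinset (Sum.inr (i, false)) =
      ({v} : Finset V).disjSum {(i, true)} := by
    ext x
    rw [SimpleGraph.mem_neighborFinset]
    rcases x with a | ⟨j, _ | _⟩ <;> simp [auxG, eq_comm]
  rw [← SimpleGraph.card_neighborFinset_eq_degree, this, Finset.card_disjSum]
  simp

lemma aux_deg_b {V : Type*} [Fintype V] (H : SimpleGraph V) (v : V) (n : ℕ)
    (B : SimpleGraph (Fin n)) (i : Fin n) :
    (auxG H v n B).degree (Sum.inr (i, true)) = 1 + B.degree i := by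
  have : (auxG H v n B).neighborFinset (Sum.inr (i, true)) =
      (∅ : Finset V).disjSum (({i} ×ˢ {false}) ∪ (B.neighborFinset i ×ˢ {true})) := by
    ext x
    rw [SimpleGraph.mem_neighborFinset]
    rcases x with a | ⟨j, _ | _⟩ <;> simp [auxG, eq_comm]
  rw [← SimpleGraph.card_neighborFinset_eq_degree, this, Finset.card_disjSum,
    Finset.card_union_of_disjoint]
  · simp
  · rw [Finset.disjoint_left]; rintro ⟨a, b⟩ h1 h2
    simp_all

/-- Graphs with equally many edges are joined by switches. -/
lemma switches_exist {W : Type*} [Fintype W] (k : ℕ) : ∀ (G1 G2 : SimpleGraph W),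
    G1.edgeFinset.card = G2.edgeFinset.card → (G1.edgeFinset \ G2.edgeFinset).card = k →
    ∃ f : ℕ → SimpleGraph W, f 0 = G1 ∧ (∀ i < k, IsKSwitch 1 (f i) (f (i + 1))) ∧ f k = G2 := by
  induction k with
  | zero =>
    intro G1 G2 hc h
    refine ⟨fun _ => G1, rfl, by simp, ?_⟩
    have h1 : G1.edgeFinset ⊆ G2.edgeFinset := by
      rw [Finset.card_eq_zero] at h
      exact Finset.sdiff_eq_empty_iff_subset.1 h
    have := Finset.eq_of_subset_of_card_le h1 hc.ge
    exact SimpleGraph.edgeFinset_inj.1 this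
  | succ k ih =>
    intro G1 G2 hc h
    have h' : (G2.edgeFinset \ G1.edgeFinset).card = k + 1 := by
      rw [← h]; exact (Finset.card_sdiff_comm hc).symm
    obtain ⟨e, he⟩ : (G1.edgeFinset \ G2.edgeFinset).Nonempty := by
      rw [← Finset.card_pos]; omega
    obtain ⟨e', he'⟩ : (G2.edgeFinset \ G1.edgeFinset).Nonempty := by
      rw [← Finset.card_pos]; omega
    rw [Finset.mem_sdiff] at he he'
    obtain ⟨G3, hG3⟩ : ∃ G3 : SimpleGraph W, G3.edgeFinset = (G1.edgeFinset \ {e}) ∪ {e'} := by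
      obtain ⟨G3, hG3⟩ : ∃ G3 : SimpleGraph W, G3 = SimpleGraph.fromEdgeSet
        (((G1.edgeFinset \ {e}) ∪ {e'} : Finset (Sym2 W)) : Set (Sym2 W)) := ⟨_, rfl⟩
      refine ⟨G3, ?_⟩
      ext d
      rw [SimpleGraph.mem_edgeFinset, hG3, SimpleGraph.edgeSet_fromEdgeSet]
      simp only [Set.mem_sdiff, Finset.mem_coe]
      constructor
      · exact fun h => h.1
      · intro h
        refine ⟨h, ?_⟩
        rw [Finset.mem_union, Finset.mem_sdiff] at h
        rcases h with h | h
        · exact SimpleGraph.not_isDiag_of_mem_edgeFinset h.1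
        · rw [Finset.mem_singleton] at h
          rw [h]
          exact SimpleGraph.not_isDiag_of_mem_edgeFinset he'.1
    have hc3 : G3.edgeFinset.card = G1.edgeFinset.card := by
      rw [hG3, Finset.card_union_of_disjoint, Finset.card_sdiff_of_subset, Finset.card_singleton, Finset.card_singleton]
      · have := Finset.card_pos.2 ⟨e, he.1⟩; omega
      · simpa using he.1
      · rw [Finset.disjoint_singleton_right]; intro h; exact he'.2 (Finset.mem_sdiff.1 h).1
    have hd : (G3.edgeFinset \ G2.edgeFinset).card = k := by
      have : G3.edgeFinset \ G2.edgeFinset = (G1.edgeFinset \ G2.edgeFinset).erase e := by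
        rw [hG3]; ext d
        simp only [Finset.mem_sdiff, Finset.mem_union, Finset.mem_erase, Finset.mem_singleton]
        constructor
        · rintro ⟨h1 | rfl, h2⟩
          · exact ⟨h1.2, h1.1, h2⟩
          · exact absurd he'.1 h2
        · tauto
      rw [this, Finset.card_erase_of_mem (Finset.mem_sdiff.2 he), h]; rfl
    obtain ⟨f, f0, fs, fk⟩ := ih G3 G2 (hc3.trans hc) hd
    refine ⟨fun i => match i with | 0 => G1 | i + 1 => f i, rfl, ?_, fk⟩
    intro i hi
    cases i with
    | zero =>
      show IsKSwitch 1 G1 (f 0)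
      rw [f0]
      exact ⟨{e}, {e'}, by simp, by simp, by simpa using he.1, hG3, hc3⟩
    | succ i => exact fs i (by omega)

lemma switches_bound {W : Type*} [Fintype W] (f : ℕ → SimpleGraph W) (ℓ : ℕ)
    (h : ∀ i < ℓ, IsKSwitch 1 (f i) (f (i + 1))) :
    ((f 0).edgeFinset \ (f ℓ).edgeFinset).card ≤ ℓ ∧
    (f ℓ).edgeFinset.card = (f 0).edgeFinset.card := by
  induction ℓ with
  | zero => simp
  | succ k ih =>
    obtain ⟨h1, h2⟩ := ih (fun i hi => h i (by omega))
    obtain ⟨R, A, hR, hA, -, hE, hc⟩ := h k (by omega)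
    refine ⟨?_, hc.trans h2⟩
    have : (f 0).edgeFinset \ (f (k+1)).edgeFinset ⊆ ((f 0).edgeFinset \ (f k).edgeFinset) ∪ R := by
      intro d hd
      rw [Finset.mem_sdiff, hE] at hd
      simp only [Finset.mem_sdiff, Finset.mem_union] at hd ⊢
      tauto
    have h3 := Finset.card_le_card this
    have h4 := Finset.card_union_le ((f 0).edgeFinset \ (f k).edgeFinset) R
    omega

lemma card_edges_sdiff {W : Type*} [Fintype W] (G K R : SimpleGraph W) (hR : R = G \ K) :
    R.edgeFinset.card = (G.edgeFinset \ K.edgeFinset).card := by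
  congr 1
  ext e
  simp [hR]

lemma switches_bound2 {W : Type*} [Fintype W] (f : ℕ → SimpleGraph W) (ℓ : ℕ)
    (h : ∀ i < ℓ, IsKSwitch 1 (f i) (f (i + 1))) (G K R A : SimpleGraph W) (hG : f 0 = G)
    (hK : f ℓ = K) (hR : R = G \ K) (hA : A = K \ G) :
    R.edgeFinset.card ≤ ℓ ∧ A.edgeFinset.card ≤ ℓ := by
  subst hG hK
  obtain ⟨h1, h2⟩ := switches_bound f ℓ h
  rw [card_edges_sdiff _ _ R hR, card_edges_sdiff _ _ A hA, Finset.card_sdiff_comm h2]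
  exact ⟨h1, h1⟩

lemma switches_exist2 {W : Type*} [Fintype W] (G1 G2 R : SimpleGraph W) (hR : R = G1 \ G2)
    (h : G1.edgeFinset.card = G2.edgeFinset.card) :
    ∃ f : ℕ → SimpleGraph W, f 0 = G1 ∧
      (∀ i < R.edgeFinset.card, IsKSwitch 1 (f i) (f (i + 1))) ∧
      f R.edgeFinset.card = G2 := by
  rw [card_edges_sdiff _ _ R hR]
  exact switches_exist _ _ _ h rfl

lemma aux_deg_b_bot {V : Type*} [Fintype V] (H : SimpleGraph V) (v : V) (n : ℕ) (i : Fin n) :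
    (auxG H v n ⊥).degree (Sum.inr (i, true)) = 1 := by
  rw [aux_deg_b, ← SimpleGraph.card_neighborFinset_eq_degree, Finset.card_eq_zero.2]
  rw [Finset.eq_empty_iff_forall_notMem]
  intro x hx
  rw [SimpleGraph.mem_neighborFinset] at hx
  exact hx

lemma ham_of_two_regular {V : Type*} [Fintype V] (G H : SimpleGraph V) (hle : H ≤ G)
    (hc : H.Connected) (hd : ∀ w, H.degree w = 2) :
    ∃ (u : V) (p : G.Walk u u), p.IsHamiltonianCycle := by
  obtain ⟨v⟩ := hc.nonempty
  have hcy : H.IsCycles := by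
    intro w _
    rw [Set.ncard_eq_toFinset_card', ← hd w]; rfl
  obtain ⟨p, hp, hs⟩ := hcy.exists_cycle_toSubgraph_verts_eq_connectedComponentSupp
    (c := H.connectedComponentMk v) (v := v) rfl (by
      have := hd v
      rw [← SimpleGraph.card_neighborFinset_eq_degree] at this
      obtain ⟨x, hx⟩ := Finset.card_pos.1 (by omega : 0 < (H.neighborFinset v).card)
      exact ⟨x, by simpa using hx⟩)
  refine ⟨v, p.mapLe hle, ?_⟩
  rw [SimpleGraph.Walk.isHamiltonianCycle_iff_isCycle_and_support_count_tail_eq_one]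
  have hcyc := hp.mapLe hle
  refine ⟨hcyc, fun w => ?_⟩
  rw [List.count_eq_one_of_mem hcyc.support_nodup]
  have hw : w ∈ p.support := by
    rw [← SimpleGraph.Walk.mem_verts_toSubgraph, hs]
    exact SimpleGraph.ConnectedComponent.sound (hc.preconnected w v)
  have hw2 : w ∈ (p.mapLe hle).support := by simpa using hw
  rw [SimpleGraph.Walk.mem_support_iff] at hw2
  rcases hw2 with rfl | h
  · exact SimpleGraph.Walk.end_mem_tail_support hcyc.not_nil
  · exact h

lemma two_regular_of_ham {V : Type*} [Fintype V] (G : SimpleGraph V) (u : V) (p : G.Walk u u)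
    (hp : p.IsHamiltonianCycle) : ∃ H : SimpleGraph V, H ≤ G ∧ H.Connected ∧ ∀ w, H.degree w = 2 := by
  refine ⟨p.toSubgraph.spanningCoe, p.toSubgraph.spanningCoe_le, ?_, ?_⟩
  · have hr : ∀ w, p.toSubgraph.spanningCoe.Reachable u w := by
      intro w
      have hw := hp.mem_support w
      let q := p.transfer p.toSubgraph.spanningCoe (by
        intro e he
        induction e with | _ a b =>
        rw [← SimpleGraph.Walk.mem_edges_toSubgraph] at he
        simpa using he)
      have hq : w ∈ q.support := by simpa [q] using hw
      exact ⟨q.takeUntil w hq⟩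
    have : Nonempty V := ⟨u⟩
    exact ⟨fun a b => (hr a).symm.trans (hr b)⟩
  · intro w
    have := hp.isCycle.ncard_neighborSet_toSubgraph_eq_two (hp.mem_support w)
    rw [← this, Set.ncard_eq_toFinset_card']
    unfold SimpleGraph.degree SimpleGraph.neighborFinset
    congr 1
    ext x; simp

lemma exists_pairing (n : ℕ) (hn : Even n) : ∃ B : SimpleGraph (Fin n), ∀ i, B.degree i = 1 := by
  obtain ⟨m, hm⟩ := hn
  let σ : Fin n → Fin n := fun i =>
    if h : i.1 % 2 = 0 then ⟨i.1 + 1, by have := i.2; omega⟩ else ⟨i.1 - 1, by have := i.2; omega⟩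
  have hσ : ∀ i, σ (σ i) = i := by
    intro i
    apply Fin.ext
    by_cases h : i.1 % 2 = 0
    · have h2 : (i.1 + 1) % 2 ≠ 0 := by omega
      simp [σ, h, h2]
    · have h2 : (i.1 - 1) % 2 = 0 := by omega
      simp [σ, h, h2]; omega
  have hσ2 : ∀ i, σ i ≠ i := by
    intro i h
    have := congrArg Fin.val h
    simp only [σ] at this
    split_ifs at this <;> simp at this <;> omega
  obtain ⟨B, hB⟩ : ∃ B : SimpleGraph (Fin n), ∀ i j, B.Adj i j ↔ σ i = j :=
    ⟨{ Adj := fun i j => σ i = j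
       symm := ⟨by rintro i j rfl; exact hσ i⟩
       loopless := ⟨fun i h => hσ2 i h⟩ }, fun _ _ => Iff.rfl⟩
  refine ⟨B, fun i => ?_⟩
  have : B.neighborFinset i = {σ i} := by
    ext j
    rw [SimpleGraph.mem_neighborFinset, Finset.mem_singleton, hB]
    exact eq_comm
  rw [← SimpleGraph.card_neighborFinset_eq_degree, this, Finset.card_singleton]

lemma sum_split {V : Type*} [Fintype V] (n : ℕ) (g : V ⊕ (Fin n × Bool) → ℕ) :
    ∑ x, g x = ∑ w, g (Sum.inl w) + (∑ i, g (Sum.inr (i, false)) + ∑ i, g (Sum.inr (i, true))) := by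
  rw [Fintype.sum_sum_type, Fintype.sum_prod_type, ← Finset.sum_add_distrib]
  congr 1
  apply Finset.sum_congr rfl
  intro i _
  rw [Fintype.sum_bool, add_comm]

lemma forward_dir {V : Type*} [Fintype V]
    (G H : SimpleGraph V) (hreg : ∀ w : V, G.degree w = 3) (v : V)
    (n : ℕ) (hn : n = Fintype.card V) (hle : H ≤ G) (hc : H.Connected) (hd : ∀ w, H.degree w = 2) :
      (∃ (ℓ : ℕ) (f : ℕ → SimpleGraph (V ⊕ (Fin n × Bool))),
        ℓ ≤ n / 2 ∧ f 0 = auxG G v n ⊥ ∧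
        (∀ i < ℓ, IsKSwitch 1 (f i) (f (i + 1))) ∧
        IsEulerianGraph (f ℓ)) := by
  have sG := G.sum_degrees_eq_twice_card_edges
  have sH := H.sum_degrees_eq_twice_card_edges
  simp only [hreg, hd, Finset.sum_const, Finset.card_univ, smul_eq_mul, ← hn] at sG sH
  have hev : Even n := by rw [Nat.even_iff]; omega
  obtain ⟨B, hB⟩ := exists_pairing n hev
  have s1 := (auxG G v n ⊥).sum_degrees_eq_twice_card_edges
  have s2 := (auxG H v n B).sum_degrees_eq_twice_card_edges
  rw [sum_split] at s1 s2
  simp only [aux_deg_b_bot] at s1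
  simp only [aux_deg_inl, aux_deg_a, aux_deg_b, hreg, hd, hB, Finset.sum_add_distrib,
    Finset.sum_const, Finset.card_univ, smul_eq_mul, ← hn, Fintype.card_fin] at s1 s2
  have hE : (auxG G v n ⊥).edgeFinset.card = (auxG H v n B).edgeFinset.card := by omega
  obtain ⟨R, hR⟩ : ∃ R, R = auxG G v n ⊥ \ auxG H v n B := ⟨_, rfl⟩
  obtain ⟨f, f0, fs, fk⟩ := switches_exist2 _ _ R hR hE
  refine ⟨_, f, ?_, f0, fs, ?_⟩
  · have hsub : R.edgeFinset ⊆
        (G.edgeFinset \ H.edgeFinset).image (Sym2.map Sum.inl) := by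
      intro e he
      induction e with | _ x y =>
      rw [SimpleGraph.mem_edgeFinset, SimpleGraph.mem_edgeSet, hR, SimpleGraph.sdiff_adj] at he
      rcases x with a | ⟨i, _ | _⟩ <;> rcases y with b | ⟨j, _ | _⟩ <;> simp [auxG] at he
      · rw [Finset.mem_image]
        refine ⟨s(a, b), ?_, by simp⟩
        simpa using he
    have h1 := (Finset.card_le_card hsub).trans Finset.card_image_le
    have h2 : (G.edgeFinset \ H.edgeFinset).card = G.edgeFinset.card - H.edgeFinset.card :=
      Finset.card_sdiff_of_subset (SimpleGraph.edgeFinset_mono hle)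
    omega
  · rw [fk]
    refine ⟨?_, ?_⟩
    · let φ : H →g auxG H v n B := ⟨Sum.inl, fun h => h⟩
      have hr1 : ∀ w, (auxG H v n B).Reachable (Sum.inl v) (Sum.inl w) := fun w =>
        (hc.preconnected v w).map φ
      have hr2 : ∀ i, (auxG H v n B).Reachable (Sum.inl v) (Sum.inr (i, false)) := fun i =>
        SimpleGraph.Adj.reachable (by simp [auxG])
      have hr3 : ∀ i, (auxG H v n B).Reachable (Sum.inl v) (Sum.inr (i, true)) := fun i =>
        (hr2 i).trans (SimpleGraph.Adj.reachable (by simp [auxG]))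
      have hr : ∀ x, (auxG H v n B).Reachable (Sum.inl v) x := by
        rintro (w | ⟨i, _ | _⟩)
        · exact hr1 w
        · exact hr2 i
        · exact hr3 i
      have : Nonempty (V ⊕ (Fin n × Bool)) := ⟨Sum.inl v⟩
      exact ⟨fun a b => (hr a).symm.trans (hr b)⟩
    · rintro (w | ⟨i, _ | _⟩)
      · rw [aux_deg_inl, hd]
        split_ifs
        · exact even_two.add hev
        · simp
      · rw [aux_deg_a]; simp
      · rw [aux_deg_b, hB]; simp

lemma deg_sdiff {W : Type*} [Fintype W] (G K R A : SimpleGraph W) (hR : R = G \ K)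
    (hA : A = K \ G) (w : W) :
    K.degree w + R.degree w = G.degree w + A.degree w := by
  have h1 : R.neighborFinset w = G.neighborFinset w \ K.neighborFinset w := by
    ext x; simp only [hR, SimpleGraph.mem_neighborFinset, Finset.mem_sdiff, SimpleGraph.sdiff_adj]
  have h2 : A.neighborFinset w = K.neighborFinset w \ G.neighborFinset w := by
    ext x; simp only [hA, SimpleGraph.mem_neighborFinset, Finset.mem_sdiff, SimpleGraph.sdiff_adj]
  simp only [← SimpleGraph.card_neighborFinset_eq_degree, h1, h2]
  have e1 := Finset.card_inter_add_card_sdiff (G.neighborFinset w) (K.neighborFinset w)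
  have e2 := Finset.card_inter_add_card_sdiff (K.neighborFinset w) (G.neighborFinset w)
  rw [Finset.inter_comm] at e2
  omega

lemma deg_zero_not_adj {W : Type*} [Fintype W] {G : SimpleGraph W} {w : W} (h : G.degree w = 0)
    (x : W) : ¬ G.Adj w x := by
  intro hx
  rw [← SimpleGraph.card_neighborFinset_eq_degree, Finset.card_eq_zero] at h
  have : x ∈ G.neighborFinset w := by simpa using hx
  rw [h] at this
  simp at this

lemma backward_dir {V : Type*} [Fintype V]
    (G : SimpleGraph V) (hreg : ∀ w : V, G.degree w = 3) (v : V)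
    (n : ℕ) (hn : n = Fintype.card V) (ℓ : ℕ) (f : ℕ → SimpleGraph (V ⊕ (Fin n × Bool)))
    (hℓ : ℓ ≤ n / 2) (f0 : f 0 = auxG G v n ⊥)
    (fs : ∀ i < ℓ, IsKSwitch 1 (f i) (f (i + 1))) (hE : IsEulerianGraph (f ℓ)) :
    ∃ H : SimpleGraph V, H ≤ G ∧ H.Connected ∧ ∀ w, H.degree w = 2 := by
  obtain ⟨K, hK⟩ : ∃ K, f ℓ = K := ⟨_, rfl⟩
  obtain ⟨R, hR⟩ : ∃ R, R = auxG G v n ⊥ \ K := ⟨_, rfl⟩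
  obtain ⟨A, hA⟩ : ∃ A, A = K \ auxG G v n ⊥ := ⟨_, rfl⟩
  obtain ⟨hb1, hb3⟩ := switches_bound2 f ℓ fs _ _ R A f0 hK hR hA
  obtain ⟨hKc, hKe⟩ := hE
  rw [hK] at hKc hKe
  have sG := G.sum_degrees_eq_twice_card_edges
  simp only [hreg, Finset.sum_const, Finset.card_univ, smul_eq_mul, ← hn] at sG
  have hev : Even n := by rw [Nat.even_iff]; omega
  have hdeg := deg_sdiff (auxG G v n ⊥) K R A hR hA
  have hRle : R ≤ auxG G v n ⊥ := hR ▸ sdiff_le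
  have hKadj : ∀ x y, K.Adj x y → (auxG G v n ⊥).Adj x y ∨ A.Adj x y := by
    intro x y h
    rw [hA, SimpleGraph.sdiff_adj]; tauto
  have hKadj2 : ∀ x y, R.Adj x y ↔ (auxG G v n ⊥).Adj x y ∧ ¬ K.Adj x y := by
    intro x y
    rw [hR, SimpleGraph.sdiff_adj]
  have sR := R.sum_degrees_eq_twice_card_edges
  have sA := A.sum_degrees_eq_twice_card_edges
  -- the lower bound on the touched degrees
  let g : V ⊕ (Fin n × Bool) → ℕ := Sum.elim (fun _ => 1) (fun q => if q.2 then 1 else 0)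
  have hg : ∑ x, g x = 2 * n := by
    rw [sum_split]
    simp [g, ← hn]; omega
  have hgle : ∀ x ∈ Finset.univ, g x ≤ R.degree x + A.degree x := by
    intro x _
    have h1 := hdeg x
    have h2 := hKe x
    rw [Nat.even_iff] at h2 hev
    rcases x with w | ⟨i, _ | _⟩
    · rw [aux_deg_inl, hreg] at h1
      simp only [g, Sum.elim_inl]
      split_ifs at h1 <;> omega
    · simp [g]
    · rw [aux_deg_b_bot] at h1
      simp only [g, Sum.elim_inr, if_true]
      omega
  have hs : ∑ x, g x = ∑ x, (R.degree x + A.degree x) := by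
    apply le_antisymm (Finset.sum_le_sum hgle)
    rw [Finset.sum_add_distrib, sR, sA, hg]
    omega
  have hpt := (Finset.sum_eq_sum_iff_of_le hgle).1 hs
  rw [hg, Finset.sum_add_distrib, sR, sA] at hs
  have ta : ∀ i, R.degree (Sum.inr (i, false)) = 0 ∧ A.degree (Sum.inr (i, false)) = 0 := by
    intro i
    have := hpt (Sum.inr (i, false)) (Finset.mem_univ _)
    simp [g] at this
    omega
  have tV : ∀ w, R.degree (Sum.inl w) + A.degree (Sum.inl w) = 1 := by
    intro w
    have := hpt (Sum.inl w) (Finset.mem_univ _)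
    simpa [g] using this.symm
  have tb : ∀ i, R.degree (Sum.inr (i, true)) = 0 := by
    intro i
    rw [← SimpleGraph.card_neighborFinset_eq_degree, Finset.card_eq_zero,
      Finset.eq_empty_iff_forall_notMem]
    intro x hx
    rw [SimpleGraph.mem_neighborFinset] at hx
    have h1 := hRle hx
    rcases x with w | ⟨j, _ | _⟩
    · simp [auxG] at h1
    · exact deg_zero_not_adj (ta j).1 _ hx.symm
    · simp [auxG] at h1
  rw [sum_split] at sR
  simp only [ta, tb, Finset.sum_const_zero, add_zero] at sR
  have hR1 : ∀ w, R.degree (Sum.inl w) = 1 := by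
    have := (Finset.sum_eq_sum_iff_of_le (s := Finset.univ) (f := fun w : V => R.degree (Sum.inl w))
      (g := fun _ => 1) (fun w _ => by have := tV w; omega)).1 (by
        rw [sR]
        simp only [Finset.sum_const, Finset.card_univ, smul_eq_mul, ← hn]
        omega)
    exact fun w => this w (Finset.mem_univ _)
  have hA0 : ∀ w, A.degree (Sum.inl w) = 0 := fun w => by
    have := tV w; have := hR1 w; omega
  obtain ⟨H, hHK⟩ : ∃ H : SimpleGraph V, ∀ a b, H.Adj a b ↔ K.Adj (Sum.inl a) (Sum.inl b) :=
    ⟨K.comap Sum.inl, fun a b => Iff.rfl⟩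
  have hHG : H ≤ G := by
    intro a b hab
    rcases hKadj _ _ ((hHK _ _).1 hab) with h | h
    · exact h
    · exact absurd h (deg_zero_not_adj (hA0 a) _)
  refine ⟨H, hHG, ?_, ?_⟩
  · let φ : V ⊕ (Fin n × Bool) → V := Sum.elim id (fun _ => v)
    have hφ : ∀ x y, K.Adj x y → H.Reachable (φ x) (φ y) := by
      intro x y hxy
      have hh := hKadj _ _ hxy
      rcases x with a | ⟨i, s⟩ <;> rcases y with b | ⟨j, t⟩
      · exact SimpleGraph.Adj.reachable ((hHK _ _).2 hxy)
      · rcases hh with h | h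
        · cases t
          · have : a = v := h
            subst this; exact SimpleGraph.Reachable.refl _
          · exact absurd h (by simp [auxG])
        · exact absurd h (deg_zero_not_adj (hA0 a) _)
      · rcases hh with h | h
        · cases s
          · have : b = v := h
            subst this; exact SimpleGraph.Reachable.refl _
          · exact absurd h (by simp [auxG])
        · exact absurd h.symm (deg_zero_not_adj (hA0 b) _)
      · exact SimpleGraph.Reachable.refl _
    have hw : ∀ x y, K.Walk x y → H.Reachable (φ x) (φ y) := by
      intro x y p
      induction p with
      | nil => exact SimpleGraph.Reachable.refl _
      | cons h _ ih => exact (hφ _ _ h).trans ih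
    have : Nonempty V := ⟨v⟩
    refine ⟨fun a b => ?_⟩
    obtain ⟨p⟩ := hKc.preconnected (Sum.inl a) (Sum.inl b)
    exact hw _ _ p
  · intro w
    obtain ⟨S, hS⟩ : ∃ S, S = G \ H := ⟨_, rfl⟩
    obtain ⟨T, hT⟩ : ∃ T, T = H \ G := ⟨_, rfl⟩
    have h1 := deg_sdiff G H S T hS hT w
    have h2 : T = ⊥ := hT.trans (sdiff_eq_bot_iff.2 hHG)
    have h3 : T.degree w = 0 := by
      rw [← SimpleGraph.card_neighborFinset_eq_degree, Finset.card_eq_zero,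
        Finset.eq_empty_iff_forall_notMem]
      intro x hx
      rw [SimpleGraph.mem_neighborFinset, h2] at hx
      exact hx
    have h4 : R.neighborFinset (Sum.inl w) = (S.neighborFinset w).disjSum ∅ := by
      ext x
      rw [SimpleGraph.mem_neighborFinset]
      rcases x with a | ⟨i, _ | _⟩
      · rw [hKadj2, Finset.inl_mem_disjSum, SimpleGraph.mem_neighborFinset, hS,
          SimpleGraph.sdiff_adj, hHK]
        exact Iff.rfl
      · simp only [Finset.inr_mem_disjSum, Finset.notMem_empty, iff_false]
        exact fun h => deg_zero_not_adj (ta i).1 _ h.symm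
      · simp only [Finset.inr_mem_disjSum, Finset.notMem_empty, iff_false]
        exact fun h => deg_zero_not_adj (tb i) _ h.symm
    have h5 := congrArg Finset.card h4
    rw [Finset.card_disjSum, SimpleGraph.card_neighborFinset_eq_degree,
      SimpleGraph.card_neighborFinset_eq_degree, hR1, Finset.card_empty] at h5
    have h6 := hreg w
    omega

theorem hamiltonian_iff_switches_to_eulerian {V : Type*} [Fintype V]
    (G : SimpleGraph V) (hreg : ∀ w : V, G.degree w = 3) (v : V)
    (n : ℕ) (hn : n = Fintype.card V) :
    (∃ (u : V) (p : G.Walk u u), p.IsHamiltonianCycle) ↔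
      (∃ (ℓ : ℕ) (f : ℕ → SimpleGraph (V ⊕ (Fin n × Bool))),
        ℓ ≤ n / 2 ∧ f 0 = attachPaths G v n ∧
        (∀ i < ℓ, IsKSwitch 1 (f i) (f (i + 1))) ∧
        IsEulerianGraph (f ℓ)) := by
  rw [attach_eq_aux]
  constructor
  · rintro ⟨u, p, hp⟩
    obtain ⟨H, h1, h2, h3⟩ := two_regular_of_ham G u p hp
    exact forward_dir G H hreg v n hn h1 h2 h3
  · rintro ⟨ℓ, f, hℓ, f0, fs, hE⟩
    obtain ⟨H, h1, h2, h3⟩ := backward_dir G hreg v n hn ℓ f hℓ f0 fs hE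
    exact ham_of_two_regular G H h1 h2 h3
end

section
/- Let G = (V, E) and H = (V, F) be two simple connected labeled graphs on the same vertex set V such that every vertex has the same degree in G as in H. Then there is a finite sequence (G = G_0, G_1, ..., G_ℓ = H) of simple graphs on V such that each graph G_i is connected and, for every i, G_{i+1} can be obtained from G_i by a degree-preserving 2-switch. -/
open SimpleGraph Finset
open scoped Classical

/-- A degree-preserving `2`-switch. -/
def IsDegreePreservingTwoSwitch {V : Type*} [Fintype V] (G G' : SimpleGraph V) : Prop :=
  IsKSwitch 2 G G' ∧ ∀ v : V, G'.degree v = G.degree v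

section
variable {V : Type*}

theorem reach_ind {K : SimpleGraph V} {p z : V} (h : K.Reachable p z) (P : V → Prop) (hp : P p)
    (hs : ∀ x y, P x → K.Adj x y → P y) : P z := by
  rw [SimpleGraph.reachable_iff_reflTransGen] at h
  induction h with
  | refl => exact hp
  | tail _ h1 ih => exact hs _ _ ih h1

theorem conn_of_adj {G G' : SimpleGraph V} (hG : G.Connected)
    (h : ∀ x y, G.Adj x y → G'.Reachable x y) : G'.Connected := by
  have := hG.nonempty
  refine ⟨fun x y => ?_⟩
  exact reach_ind (hG.preconnected x y) (fun z => G'.Reachable x z) (SimpleGraph.Reachable.refl _)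
    (fun a b h1 h2 => h1.trans (h a b h2))

/-- the switch removing `ab`, `cd` and adding `ac`, `bd` -/
def sw (G : SimpleGraph V) (a b c d : V) : SimpleGraph V where
  Adj x y := x ≠ y ∧ ((G.Adj x y ∧ ¬ ((x = a ∧ y = b) ∨ (x = b ∧ y = a) ∨ (x = c ∧ y = d) ∨
    (x = d ∧ y = c))) ∨ ((x = a ∧ y = c) ∨ (x = c ∧ y = a) ∨ (x = b ∧ y = d) ∨ (x = d ∧ y = b)))
  symm := ⟨by
    intro x y h
    have := G.adj_comm x y
    tauto⟩
  loopless := ⟨by intro x h; exact h.1 rfl⟩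

structure Valid (G : SimpleGraph V) (a b c d : V) : Prop where
  ab : G.Adj a b
  cd : G.Adj c d
  ac : ¬ G.Adj a c
  bd : ¬ G.Adj b d
  nac : a ≠ c
  nbd : b ≠ d

theorem Valid.nes {G : SimpleGraph V} {a b c d : V} (h : Valid G a b c d) :
    a ≠ b ∧ c ≠ d ∧ a ≠ d ∧ b ≠ c := by
  obtain ⟨h1, h2, h3, h4, h5, h6⟩ := h
  refine ⟨h1.ne, h2.ne, ?_, ?_⟩
  · rintro rfl; exact h3 h2.symm
  · rintro rfl; exact h3 h1

theorem Valid.sw_valid {G : SimpleGraph V} {a b c d : V} (h : Valid G a b c d) :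
    Valid (sw G a b c d) a c b d := by
  have := h.nes
  obtain ⟨h1, h2, h3, h4, h5, h6⟩ := h
  constructor <;> (try simp only [sw]) <;> grind

theorem Valid.sw_sw {G : SimpleGraph V} {a b c d : V} (h : Valid G a b c d) :
    sw (sw G a b c d) a c b d = G := by
  have := h.nes
  obtain ⟨h1, h2, h3, h4, h5, h6⟩ := h
  ext x y
  have := G.adj_comm x y
  have h1' := h1.symm
  have h2' := h2.symm
  have : G.Adj x y → x ≠ y := fun h => h.ne
  have := G.adj_comm a c
  have := G.adj_comm b d
  simp only [sw]
  constructor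
  · grind
  · intro h
    grind

theorem Valid.conn {G : SimpleGraph V} {a b c d : V} (h : Valid G a b c d) (hG : G.Connected)
    (hr : (sw G a b c d).Reachable a b) : (sw G a b c d).Connected := by
  have hv := h.sw_valid
  have hac := hv.ab.reachable
  have hbd := hv.cd.reachable
  have hcd := (hac.symm.trans hr).trans hbd
  refine conn_of_adj hG fun x y hxy => ?_
  by_cases hh : ((x = a ∧ y = b) ∨ (x = b ∧ y = a) ∨ (x = c ∧ y = d) ∨ (x = d ∧ y = c))
  · rcases hh with ⟨rfl, rfl⟩ | ⟨rfl, rfl⟩ | ⟨rfl, rfl⟩ | ⟨rfl, rfl⟩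
    exacts [hr, hr.symm, hcd, hcd.symm]
  · exact SimpleGraph.Adj.reachable (show (sw G a b c d).Adj x y from ⟨hxy.ne, Or.inl ⟨hxy, hh⟩⟩)

noncomputable def dg (G : SimpleGraph V) (v : V) : ℕ := (G.neighborSet v).ncard

theorem sw_symm1 (G : SimpleGraph V) (a b c d : V) : sw G a b c d = sw G b a d c := by
  ext x y; simp only [sw]; tauto

theorem sw_symm2 (G : SimpleGraph V) (a b c d : V) : sw G a b c d = sw G c d a b := by
  ext x y; simp only [sw]; tauto

theorem Valid.symm1 {G : SimpleGraph V} {a b c d : V} (h : Valid G a b c d) : Valid G b a d c :=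
  ⟨h.ab.symm, h.cd.symm, h.bd, h.ac, h.nbd, h.nac⟩

theorem Valid.symm2 {G : SimpleGraph V} {a b c d : V} (h : Valid G a b c d) : Valid G c d a b :=
  ⟨h.cd, h.ab, fun h1 => h.ac h1.symm, fun h1 => h.bd h1.symm, h.nac.symm, h.nbd.symm⟩

theorem Valid.dg_a [Finite V] {G : SimpleGraph V} {a b c d : V} (h : Valid G a b c d) :
    dg (sw G a b c d) a = dg G a := by
  have := h.nes
  obtain ⟨h1, h2, h3, h4, h5, h6⟩ := h
  have e : (sw G a b c d).neighborSet a = insert c (G.neighborSet a \ {b}) := by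
    ext y
    have : G.Adj a y → a ≠ y := fun h => h.ne
    simp only [sw, SimpleGraph.mem_neighborSet, Set.mem_insert_iff, Set.mem_sdiff,
      Set.mem_singleton_iff]
    grind
  unfold dg
  rw [e, Set.ncard_insert_of_notMem (by simp [h3]) (Set.toFinite _),
    Set.ncard_sdiff_singleton_add_one (by simpa using h1) (Set.toFinite _)]

theorem Valid.dg_eq [Finite V] {G : SimpleGraph V} {a b c d : V} (h : Valid G a b c d) (v : V) :
    dg (sw G a b c d) v = dg G v := by
  by_cases ha : v = a
  · subst ha; exact h.dg_a
  by_cases hb : v = b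
  · subst hb; rw [sw_symm1]; exact h.symm1.dg_a
  by_cases hc : v = c
  · subst hc; rw [sw_symm2]; exact h.symm2.dg_a
  by_cases hd : v = d
  · subst hd; rw [sw_symm2, sw_symm1]; exact h.symm2.symm1.dg_a
  unfold dg
  congr 1
  ext y
  have : G.Adj v y → v ≠ y := fun h => h.ne
  simp only [sw, SimpleGraph.mem_neighborSet]
  grind

/-- one connected switch -/
def CS (G G' : SimpleGraph V) : Prop :=
  G.Connected ∧ G'.Connected ∧ ∃ a b c d, Valid G a b c d ∧ G' = sw G a b c d

theorem CS.symm {G G' : SimpleGraph V} (h : CS G G') : CS G' G := by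
  obtain ⟨h1, h2, a, b, c, d, hv, rfl⟩ := h
  exact ⟨h2, h1, a, c, b, d, hv.sw_valid, hv.sw_sw.symm⟩

abbrev Rch (G G' : SimpleGraph V) : Prop := Relation.ReflTransGen CS G G'

theorem Rch.symm' {G G' : SimpleGraph V} (h : Rch G G') : Rch G' G := by
  induction h with
  | refl => exact Relation.ReflTransGen.refl
  | tail _ h1 ih => exact Relation.ReflTransGen.head h1.symm ih

theorem Rch.conn {G G' : SimpleGraph V} (h : Rch G G') (hG : G.Connected) : G'.Connected := by
  induction h with
  | refl => exact hG
  | tail _ h1 ih => exact h1.2.1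

theorem Rch.dg_eq [Finite V] {G G' : SimpleGraph V} (h : Rch G G') (v : V) : dg G' v = dg G v := by
  induction h with
  | refl => rfl
  | tail _ h1 ih =>
    obtain ⟨h1, h2, a, b, c, d, hv, rfl⟩ := h1
    rw [hv.dg_eq, ih]

/-- exchange lemma -/
theorem exchange [Finite V] {G : SimpleGraph V} (hG : G.Connected) {v u w : V} (hvu : G.Adj v u)
    (hvw : ¬ G.Adj v w) (hne : v ≠ w) (hd : dg G u ≤ dg G w) :
    ∃ x, Valid G v u w x ∧ (sw G v u w x).Connected := by
  have huw : u ≠ w := by rintro rfl; exact hvw hvu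
  -- a first candidate
  obtain ⟨x, hwx, hux, hxu⟩ : ∃ x, G.Adj w x ∧ ¬ G.Adj u x ∧ u ≠ x := by
    by_contra! hcon
    have hsub : insert v (G.neighborSet w \ {u}) ⊆ G.neighborSet u \ {w} := by
      intro y hy
      rcases hy with rfl | ⟨hy, hyu⟩
      · exact ⟨hvu.symm, hne⟩
      · refine ⟨?_, fun h => ?_⟩
        · by_contra h
          exact hyu (hcon y hy h).symm
        · simp only [Set.mem_singleton_iff] at h
          subst h; exact G.loopless.irrefl _ hy
    have h1 := Set.ncard_le_ncard hsub (Set.toFinite _)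
    rw [Set.ncard_insert_of_notMem (fun h => hvw (SimpleGraph.Adj.symm h.1)) (Set.toFinite _)] at h1
    unfold dg at hd
    by_cases hadj : G.Adj u w
    · have e1 := Set.ncard_sdiff_singleton_add_one (a := u) (s := G.neighborSet w) hadj.symm
        (Set.toFinite _)
      have e2 := Set.ncard_sdiff_singleton_add_one (a := w) (s := G.neighborSet u) hadj
        (Set.toFinite _)
      omega
    · rw [Set.sdiff_singleton_eq_self (s := G.neighborSet w)
          (fun h => hadj (SimpleGraph.Adj.symm h)),
        Set.sdiff_singleton_eq_self (s := G.neighborSet u) (fun h => hadj h)] at h1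
      omega
  have hv : Valid G v u w x := ⟨hvu, hwx, hvw, hux, hne, hxu⟩
  by_cases hr : (sw G v u w x).Reachable v u
  · exact ⟨x, hv, hv.conn hG hr⟩
  have hvx : v ≠ x := hv.nes.2.2.1
  -- `A` is the side of `v`
  set A : Set V := {z | (sw G v u w x).Reachable v z} with hA
  have hvA : v ∈ A := SimpleGraph.Reachable.refl _
  have hwA : w ∈ A := hv.sw_valid.ab.reachable
  have huA : u ∉ A := hr
  have hxA : x ∉ A := fun h => hr (SimpleGraph.Reachable.trans h hv.sw_valid.cd.reachable.symm)
  have hcross : ∀ y z, y ∈ A → z ∉ A → G.Adj y z → (y = v ∧ z = u) ∨ (y = w ∧ z = x) := by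
    intro y z hy hz hyz
    by_contra hcon
    apply hz
    refine SimpleGraph.Reachable.trans hy (SimpleGraph.Adj.reachable ⟨hyz.ne, Or.inl ⟨hyz, ?_⟩⟩)
    rintro (h | ⟨rfl, rfl⟩ | h | ⟨rfl, rfl⟩)
    · exact hcon (Or.inl h)
    · exact hr hy
    · exact hcon (Or.inr h)
    · exact hxA hy
  have hgood : ∀ y, G.Adj w y → y ≠ x → y ∈ A ∧ Valid G v u w y := by
    intro y hwy hyx
    have hyA : y ∈ A := by
      by_contra h
      rcases hcross w y hwA h hwy with h | h
      · exact hne h.1.symm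
      · exact hyx h.2
    have hyv : y ≠ v := by rintro rfl; exact hvw hwy.symm
    refine ⟨hyA, hvu, hwy, hvw, fun h => ?_, hne, fun h => huA (h ▸ hyA)⟩
    rcases hcross y u hyA huA h.symm with h1 | h1
    · exact hyv h1.1
    · exact hwy.ne h1.1.symm
  -- the graph restricted to `A`
  let B : SimpleGraph V := ⟨fun y z => G.Adj y z ∧ y ∈ A ∧ z ∈ A,
    ⟨fun y z h => ⟨h.1.symm, h.2.2, h.2.1⟩⟩, ⟨fun y h => h.1.ne rfl⟩⟩
  by_cases hc : B.Reachable w v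
  · obtain ⟨p, hp⟩ := hc.exists_isPath
    cases p with
    | nil => exact absurd rfl hne
    | @cons _ y _ hwy q =>
      rw [SimpleGraph.Walk.cons_isPath_iff] at hp
      obtain ⟨hyA, hvy⟩ := hgood y hwy.1 (fun h => hxA (h ▸ hwy.2.2))
      refine ⟨y, hvy, hvy.conn hG ?_⟩
      have key : (sw G v u w y).Reachable y v := by
        refine ⟨q.transfer _ ?_⟩
        intro e he
        induction e using Sym2.ind with
        | _ s t =>
          have h1 := q.adj_of_mem_edges he
          have hs := q.fst_mem_support_of_mem_edges he
          have ht := q.snd_mem_support_of_mem_edges he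
          refine ⟨h1.1.ne, Or.inl ⟨h1.1, ?_⟩⟩
          rintro (⟨rfl, rfl⟩ | ⟨rfl, rfl⟩ | ⟨rfl, rfl⟩ | ⟨rfl, rfl⟩)
          · exact huA h1.2.2
          · exact huA h1.2.1
          · exact hp.2 hs
          · exact hp.2 ht
      exact key.symm.trans hvy.sw_valid.cd.reachable.symm
  · -- the graph restricted to the complement of `A`
    let C : SimpleGraph V := ⟨fun y z => G.Adj y z ∧ y ∉ A ∧ z ∉ A,
      ⟨fun y z h => ⟨h.1.symm, h.2.2, h.2.1⟩⟩, ⟨fun y h => h.1.ne rfl⟩⟩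
    have hBA : ∀ z, B.Reachable v z → z ∈ A := fun z hz =>
      reach_ind hz (fun z => z ∈ A) hvA (fun _ _ _ h => h.2.2)
    have hCA : ∀ z, C.Reachable u z → z ∉ A := fun z hz =>
      reach_ind hz (fun z => z ∉ A) huA (fun _ _ _ h => h.2.2)
    have hux' : C.Reachable u x := by
      by_contra hcx
      have := reach_ind (hG.preconnected v w) (fun z => B.Reachable v z ∨ C.Reachable u z)
        (Or.inl (SimpleGraph.Reachable.refl _)) (by
          rintro y z (hy | hy) hyz
          · by_cases hz : z ∈ A
            · exact Or.inl (hy.trans (SimpleGraph.Adj.reachable ⟨hyz, hBA _ hy, hz⟩))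
            · rcases hcross y z (hBA _ hy) hz hyz with ⟨rfl, rfl⟩ | ⟨rfl, rfl⟩
              · exact Or.inr (SimpleGraph.Reachable.refl _)
              · exact absurd hy.symm hc
          · by_cases hz : z ∈ A
            · rcases hcross z y hz (hCA _ hy) hyz.symm with ⟨rfl, rfl⟩ | ⟨rfl, rfl⟩
              · exact Or.inl (SimpleGraph.Reachable.refl _)
              · exact absurd hy hcx
            · exact Or.inr (hy.trans (SimpleGraph.Adj.reachable ⟨hyz, hCA _ hy, hz⟩)))
      rcases this with h | h
      · exact hc h.symm
      · exact hCA _ h hwA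
    have hu2 : 2 ≤ dg G u := by
      obtain ⟨p⟩ := hux'
      cases p with
      | nil => exact absurd rfl hxu
      | @cons _ y _ huy q =>
        have hvy : v ≠ y := fun h => huy.2.2 (h ▸ hvA)
        unfold dg
        rw [← Set.ncard_pair hvy]
        refine Set.ncard_le_ncard ?_ (Set.toFinite _)
        rintro z (rfl | rfl)
        · exact hvu.symm
        · exact huy.1
    obtain ⟨y, hwy, hyx⟩ : ∃ y, G.Adj w y ∧ y ≠ x := by
      obtain ⟨y, hy, hyx⟩ := Set.exists_ne_of_one_lt_ncard
        (show 1 < (G.neighborSet w).ncard from lt_of_lt_of_le hu2 hd) x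
      exact ⟨y, hy, hyx⟩
    obtain ⟨hyA, hvy⟩ := hgood y hwy hyx
    refine ⟨y, hvy, hvy.conn hG ?_⟩
    have h1 : (sw G v u w y).Reachable v w := hvy.sw_valid.ab.reachable
    have h2 : (sw G v u w y).Reachable w x := by
      refine SimpleGraph.Adj.reachable ⟨hwx.ne, Or.inl ⟨hwx, ?_⟩⟩
      have := hwy.ne
      grind
    have h3 : (sw G v u w y).Reachable u x := by
      refine (reach_ind hux' (fun z => (sw G v u w y).Reachable u z)
        (SimpleGraph.Reachable.refl _) ?_)
      intro s t hs hst
      refine hs.trans (SimpleGraph.Adj.reachable ⟨hst.1.ne, Or.inl ⟨hst.1, ?_⟩⟩)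
      rintro (⟨rfl, rfl⟩ | ⟨rfl, rfl⟩ | ⟨rfl, rfl⟩ | ⟨rfl, rfl⟩)
      exacts [hst.2.1 hvA, hst.2.2 hvA, hst.2.1 hwA, hst.2.2 hwA]
    exact (h1.trans h2).trans h3.symm

end

section
variable {V : Type*}

/-- isolate the vertex `v` -/
def delV (G : SimpleGraph V) (v : V) : SimpleGraph V :=
  ⟨fun y z => G.Adj y z ∧ y ≠ v ∧ z ≠ v,
    ⟨fun y z h => ⟨h.1.symm, h.2.2, h.2.1⟩⟩, ⟨fun y h => h.1.ne rfl⟩⟩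

theorem dg_eq_degree (G : SimpleGraph V) (v : V) [Fintype (G.neighborSet v)] :
    dg G v = G.degree v := by
  unfold dg
  rw [Set.ncard_eq_toFinset_card', SimpleGraph.degree, SimpleGraph.neighborFinset]

theorem exists_nonbridge [Fintype V] {G : SimpleGraph V} (hG : G.Connected) {v p q : V}
    (hmin : ∀ x, dg G v ≤ dg G x) (hp : p ≠ v) (hq : q ≠ v) (hpq : ¬ (delV G v).Reachable p q) :
    2 ≤ dg G v ∧ ∃ a b, (delV G v).Reachable p a ∧ (delV G v).Reachable p b ∧ G.Adj a b ∧
      ((delV G v).deleteEdges {s(a, b)}).Reachable a b := by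
  set K := delV G v with hK
  set C : Set V := {z | K.Reachable p z} with hC
  have hpC : p ∈ C := SimpleGraph.Reachable.refl _
  have hqC : q ∉ C := hpq
  have hvC : ∀ z ∈ C, z ≠ v := fun z hz => reach_ind hz (fun z => z ≠ v) hp (fun _ _ _ h => h.2.2)
  have hvC' : v ∉ C := fun h => hvC v h rfl
  have hclosed : ∀ x ∈ C, ∀ y, y ≠ v → G.Adj x y → y ∈ C := fun x hx y hy hxy =>
    SimpleGraph.Reachable.trans hx (SimpleGraph.Adj.reachable ⟨hxy, hvC x hx, hy⟩)
  obtain ⟨s, hsC, hvs⟩ : ∃ s ∈ C, G.Adj v s := by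
    by_contra! hcon
    exact hvC' (reach_ind (hG.preconnected p v) (fun z => z ∈ C) hpC (fun x y hx hxy =>
      hclosed x hx y (by rintro rfl; exact hcon x hx hxy.symm) hxy))
  obtain ⟨t, htC, hvt⟩ : ∃ t, t ∉ C ∧ G.Adj v t := by
    by_contra! hcon
    have := (reach_ind (hG.preconnected q v) (fun z => z ∉ C ∧ z ≠ v) ⟨hqC, hq⟩
      (fun x y hx hxy => by
        have hyv : y ≠ v := by rintro rfl; exact hcon x hx.1 hxy.symm
        exact ⟨fun hy => hx.1 (hclosed y hy x hx.2 hxy.symm), hyv⟩))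
    exact this.2 rfl
  have hd2 : 2 ≤ dg G v := by
    unfold dg
    have hst : s ≠ t := by rintro rfl; exact htC hsC
    rw [← Set.ncard_pair hst]
    refine Set.ncard_le_ncard ?_ (Set.toFinite _)
    rintro z (rfl | rfl) <;> assumption
  refine ⟨hd2, ?_⟩
  have hNC : (G.neighborSet v ∩ C).ncard + 1 ≤ dg G v := by
    unfold dg
    refine Set.ncard_lt_ncard ?_ (Set.toFinite _)
    refine ⟨Set.inter_subset_left, fun h => htC (h hvt).2⟩
  by_contra hcon
  let T := G.induce C
  have hTK : ∀ x y : C, T.Adj x y → K.Adj x y := fun x y h => ⟨h, hvC x x.2, hvC y y.2⟩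
  have hTc : T.Connected := by
    have key : ∀ z, K.Reachable p z → ∃ hz : z ∈ C, T.Reachable ⟨p, hpC⟩ ⟨z, hz⟩ := by
      intro z hz
      refine reach_ind hz (fun z => ∃ hz : z ∈ C, T.Reachable ⟨p, hpC⟩ ⟨z, hz⟩)
        ⟨hpC, SimpleGraph.Reachable.refl _⟩ ?_
      rintro x y ⟨hx, hx'⟩ hxy
      have hy := hclosed x hx y hxy.2.2 hxy.1
      exact ⟨hy, hx'.trans (SimpleGraph.Adj.reachable (show T.Adj ⟨x, hx⟩ ⟨y, hy⟩ from hxy.1))⟩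
    have : Nonempty C := ⟨⟨p, hpC⟩⟩
    refine ⟨fun x y => ?_⟩
    exact (key x x.2).2.symm.trans (key y y.2).2
  have hTa : T.IsAcyclic := by
    rw [SimpleGraph.isAcyclic_iff_forall_adj_isBridge]
    intro a b hab
    rw [SimpleGraph.isBridge_iff]
    intro hr
    refine hcon ⟨a, b, a.2, b.2, hab, ?_⟩
    refine reach_ind hr (fun z => (K.deleteEdges {s((a : V), (b : V))}).Reachable a z)
      (SimpleGraph.Reachable.refl _) ?_
    intro x y hx hxy
    refine hx.trans (SimpleGraph.Adj.reachable ?_)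
    rw [SimpleGraph.deleteEdges_adj] at hxy ⊢
    refine ⟨hTK _ _ hxy.1, fun h => hxy.2 ?_⟩
    simp only [Set.mem_singleton_iff, Sym2.eq_iff] at h ⊢
    simpa [Subtype.ext_iff] using h
  have hT : T.IsTree := ⟨hTc, hTa⟩
  have h1 := hT.card_edgeFinset
  have h2 := T.sum_degrees_eq_twice_card_edges
  have h3 : ∀ x : C, dg G v ≤ T.degree x + if G.Adj v x then 1 else 0 := by
    intro x
    rw [← dg_eq_degree]
    refine (hmin x).trans ?_
    have hinj : (Subtype.val '' T.neighborSet x).ncard = dg T x :=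
      Set.ncard_image_of_injective _ Subtype.val_injective
    rw [← hinj]
    have hn : ∀ y, G.Adj x y → y ≠ v → y ∈ Subtype.val '' T.neighborSet x := by
      intro y hy hyv
      exact ⟨⟨y, hclosed x x.2 y hyv hy⟩, hy, rfl⟩
    split_ifs with hadj
    · refine le_trans (Set.ncard_le_ncard (t := insert v (Subtype.val '' T.neighborSet x)) ?_
        (Set.toFinite _)) (Set.ncard_insert_le _ _)
      intro y hy
      by_cases hyv : y = v
      · exact Or.inl hyv
      · exact Or.inr (hn y hy hyv)
    · refine Set.ncard_le_ncard ?_ (Set.toFinite _)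
      intro y hy
      exact hn y hy (by rintro rfl; exact hadj (SimpleGraph.Adj.symm hy))
  have h4 : ∑ x : C, dg G v ≤ ∑ x : C, (T.degree x + if G.Adj v x then 1 else 0) :=
    Finset.sum_le_sum fun x _ => h3 x
  rw [Finset.sum_add_distrib, h2, Finset.sum_boole, Finset.sum_const, Finset.card_univ,
    smul_eq_mul] at h4
  have h5 : (Finset.univ.filter (fun x : C => G.Adj v x)).card = (G.neighborSet v ∩ C).ncard := by
    rw [← Set.ncard_coe_finset, ← Set.ncard_image_of_injective _ Subtype.val_injective]
    congr 1
    ext y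
    simp [and_comm]
  rw [h5] at h4
  obtain ⟨e, he⟩ := Nat.exists_eq_add_of_le hd2
  rw [he] at h4 hNC
  rw [← h1] at h4
  push_cast at h4
  nlinarith

theorem grow [Fintype V] {G : SimpleGraph V} (hG : G.Connected) {v p q : V}
    (hmin : ∀ x, dg G v ≤ dg G x) (hp : p ≠ v) (hq : q ≠ v) (hpq : ¬ (delV G v).Reachable p q) :
    ∃ G', CS G G' ∧ (∀ x, G'.Adj v x ↔ G.Adj v x) ∧
      {z | (delV G v).Reachable p z} ⊂ {z | (delV G' v).Reachable p z} := by
  obtain ⟨hd2, a, b, ha, hb, hab, hr⟩ := exists_nonbridge hG hmin hp hq hpq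
  have hne : ∀ z, (delV G v).Reachable p z → z ≠ v := fun z hz =>
    reach_ind hz (fun z => z ≠ v) hp (fun _ _ _ h => h.2.2)
  obtain ⟨d, hqd, hdv⟩ : ∃ d, G.Adj q d ∧ d ≠ v := by
    obtain ⟨y, hy, hyx⟩ := Set.exists_ne_of_one_lt_ncard
      (show 1 < (G.neighborSet q).ncard from lt_of_lt_of_le hd2 (hmin q)) v
    exact ⟨y, hy, hyx⟩
  have hcl : ∀ x y, (delV G v).Reachable p x → y ≠ v → G.Adj x y → (delV G v).Reachable p y :=
    fun x y hx hy hxy => hx.trans (SimpleGraph.Adj.reachable ⟨hxy, hne x hx, hy⟩)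
  have hpd : ¬ (delV G v).Reachable p d := fun h => hpq (hcl d q h hq hqd.symm)
  have hv : Valid G a b q d := ⟨hab, hqd, fun h => hpq (hcl a q ha hq h),
    fun h => hpd (hcl b d hb hdv h), fun h => hpq (h ▸ ha), fun h => hpd (h ▸ hb)⟩
  set G' := sw G a b q d with hG'
  have hav := hne a ha
  have hbv := hne b hb
  -- old walks avoiding `ab` survive
  have hab' : (delV G' v).Reachable a b := by
    have : (delV G v).Reachable p b ∧ (delV G' v).Reachable a b := by
      refine reach_ind hr (fun z => (delV G v).Reachable p z ∧ (delV G' v).Reachable a z)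
        ⟨ha, SimpleGraph.Reachable.refl _⟩ ?_
      rintro x y ⟨hx, hx'⟩ hxy
      rw [SimpleGraph.deleteEdges_adj] at hxy
      obtain ⟨hxy, hn⟩ := hxy
      have hy := hcl x y hx hxy.2.2 hxy.1
      refine ⟨hy, hx'.trans (SimpleGraph.Adj.reachable ⟨⟨hxy.1.ne, Or.inl ⟨hxy.1, ?_⟩⟩, hxy.2⟩)⟩
      rintro (⟨rfl, rfl⟩ | ⟨rfl, rfl⟩ | ⟨rfl, rfl⟩ | ⟨rfl, rfl⟩)
      · exact hn rfl
      · exact hn Sym2.eq_swap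
      · exact hpq hx
      · exact hpd hx
    exact this.2
  have hle : ∀ x y, (delV G' v).Reachable x y → G'.Reachable x y := fun x y h =>
    h.mono (show delV G' v ≤ G' from fun _ _ h => h.1)
  have hold : ∀ z, (delV G v).Reachable p z → (delV G' v).Reachable p z := by
    intro z hz
    have : (delV G v).Reachable p z ∧ (delV G' v).Reachable p z := by
      refine reach_ind hz (fun z => (delV G v).Reachable p z ∧ (delV G' v).Reachable p z)
        ⟨SimpleGraph.Reachable.refl _, SimpleGraph.Reachable.refl _⟩ ?_
      rintro x y ⟨hx, hx'⟩ hxy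
      have hy := hcl x y hx hxy.2.2 hxy.1
      refine ⟨hy, hx'.trans ?_⟩
      by_cases hh : ((x = a ∧ y = b) ∨ (x = b ∧ y = a) ∨ (x = q ∧ y = d) ∨ (x = d ∧ y = q))
      · rcases hh with ⟨rfl, rfl⟩ | ⟨rfl, rfl⟩ | ⟨rfl, rfl⟩ | ⟨rfl, rfl⟩
        · exact hab'
        · exact hab'.symm
        · exact absurd hx hpq
        · exact absurd hx hpd
      · exact SimpleGraph.Adj.reachable ⟨⟨hxy.1.ne, Or.inl ⟨hxy.1, hh⟩⟩, hxy.2⟩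
    exact this.2
  refine ⟨G', ⟨hG, hv.conn hG (hle _ _ hab'), a, b, q, d, hv, rfl⟩, ?_, hold, fun h => hpq (h ?_)⟩
  · intro x
    have : G.Adj v x → v ≠ x := fun h => h.ne
    simp only [hG', sw]
    grind
  · exact (hold a ha).trans (SimpleGraph.Adj.reachable ⟨hv.sw_valid.ab, hav, hq⟩)

theorem make_conn [Fintype V] {v p : V} (hp : p ≠ v) : ∀ (n : ℕ) (G : SimpleGraph V),
    G.Connected → (∀ x, dg G v ≤ dg G x) →
    Fintype.card V - {z | (delV G v).Reachable p z}.ncard = n →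
    ∃ G', Rch G G' ∧ (∀ x, G'.Adj v x ↔ G.Adj v x) ∧ ∀ z, z ≠ v → (delV G' v).Reachable p z := by
  intro n
  induction n using Nat.strong_induction_on with
  | _ n ih =>
    intro G hG hmin hn
    by_cases h : ∀ z, z ≠ v → (delV G v).Reachable p z
    · exact ⟨G, Relation.ReflTransGen.refl, fun _ => Iff.rfl, h⟩
    push Not at h
    obtain ⟨q, hq, hpq⟩ := h
    obtain ⟨G', hcs, hN, hss⟩ := grow hG hmin hp hq hpq
    have hR : Rch G G' := Relation.ReflTransGen.single hcs
    have h1 := Set.ncard_lt_ncard hss (Set.toFinite _)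
    have h2 : {z | (delV G' v).Reachable p z}.ncard ≤ Fintype.card V := by
      rw [← Nat.card_eq_fintype_card]; exact Set.ncard_le_card _
    obtain ⟨G2, hR2, hN2, hz⟩ := ih _ (by omega) G' hcs.2.1
      (fun x => by rw [hR.dg_eq, hR.dg_eq]; exact hmin x) rfl
    exact ⟨G2, hR.trans hR2, fun x => (hN2 x).trans (hN x), hz⟩

/-- make the neighbourhoods of `v` agree -/
theorem make_nbr [Finite V] (v : V) : ∀ (n : ℕ) (G H : SimpleGraph V), G.Connected → H.Connected →
    (∀ x, dg G x = dg H x) → (G.neighborSet v \ H.neighborSet v).ncard = n →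
    ∃ G' H', Rch G G' ∧ Rch H H' ∧ ∀ x, G'.Adj v x ↔ H'.Adj v x := by
  intro n
  induction n using Nat.strong_induction_on with
  | _ n ih =>
    intro G H hG hH hdeg hn
    by_cases h : ∀ x, G.Adj v x ↔ H.Adj v x
    · exact ⟨G, H, Relation.ReflTransGen.refl, Relation.ReflTransGen.refl, h⟩
    have e := hdeg v
    unfold dg at e
    have hneq : G.neighborSet v ≠ H.neighborSet v := fun h1 => h fun x => by
      rw [← SimpleGraph.mem_neighborSet, h1, SimpleGraph.mem_neighborSet]
    obtain ⟨u, huG, huH⟩ : ∃ u, G.Adj v u ∧ ¬ H.Adj v u := by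
      by_contra! hc
      exact hneq (Set.eq_of_subset_of_ncard_le hc e.ge (Set.toFinite _))
    obtain ⟨w, hwH, hwG⟩ : ∃ w, H.Adj v w ∧ ¬ G.Adj v w := by
      by_contra! hc
      exact hneq (Set.eq_of_subset_of_ncard_le hc e.le (Set.toFinite _)).symm
    rcases le_total (dg G u) (dg G w) with hle | hle
    · obtain ⟨x, hv, hc⟩ := exchange hG huG hwG hwH.ne hle
      have hR : Rch G (sw G v u w x) := Relation.ReflTransGen.single ⟨hG, hc, _, _, _, _, hv, rfl⟩
      have hlt : ((sw G v u w x).neighborSet v \ H.neighborSet v).ncard < n := by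
        rw [← hn]
        refine Set.ncard_lt_ncard ⟨?_, fun hs => ?_⟩ (Set.toFinite _)
        · have := hv.nes
          rintro y ⟨hy, hyH⟩
          refine ⟨?_, hyH⟩
          simp only [sw, SimpleGraph.mem_neighborSet] at hy hyH ⊢
          grind
        · have h1 := (hs ⟨huG, huH⟩).1
          have := hv.nes
          simp only [sw, SimpleGraph.mem_neighborSet] at h1
          grind
      obtain ⟨G', H', h1, h2, h3⟩ := ih _ hlt _ H hc hH
        (fun y => by rw [hv.dg_eq, hdeg]) rfl
      exact ⟨G', H', hR.trans h1, h2, h3⟩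
    · rw [hdeg, hdeg] at hle
      obtain ⟨x, hv, hc⟩ := exchange hH hwH huH huG.ne hle
      have hR : Rch H (sw H v w u x) := Relation.ReflTransGen.single ⟨hH, hc, _, _, _, _, hv, rfl⟩
      have hlt : (G.neighborSet v \ (sw H v w u x).neighborSet v).ncard < n := by
        rw [← hn]
        refine Set.ncard_lt_ncard ⟨?_, fun hs => ?_⟩ (Set.toFinite _)
        · have := hv.nes
          rintro y ⟨hy, hyH⟩
          refine ⟨hy, fun hyH' => hyH ?_⟩
          have h0 := SimpleGraph.Adj.ne hyH'
          have hyw : y ≠ w := by rintro rfl; exact hwG hy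
          refine ⟨h0, Or.inl ⟨hyH', ?_⟩⟩
          have hvu := huG.ne
          clear ih hR
          tauto
        · have h1 := (hs ⟨huG, huH⟩).2
          exact h1 hv.sw_valid.ab
      obtain ⟨G', H', h1, h2, h3⟩ := ih _ hlt G _ hG hc
        (fun y => by rw [hv.dg_eq, hdeg]) rfl
      exact ⟨G', H', h1, hR.trans h2, h3⟩

/-- put `K` on the complement of `v`, keeping the neighbours of `v` in `G` -/
def lft (G : SimpleGraph V) (v : V) (K : SimpleGraph {x // x ≠ v}) : SimpleGraph V :=
  ⟨fun x y => (∃ (hx : x ≠ v) (hy : y ≠ v), K.Adj ⟨x, hx⟩ ⟨y, hy⟩) ∨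
      (G.Adj x y ∧ (x = v ∨ y = v)),
    ⟨fun x y h => by
      rcases h with ⟨hx, hy, h⟩ | ⟨h, h1⟩
      · exact Or.inl ⟨hy, hx, h.symm⟩
      · exact Or.inr ⟨h.symm, h1.symm⟩⟩,
    ⟨fun x h => by
      rcases h with ⟨hx, hy, h⟩ | ⟨h, h1⟩
      · exact h.ne rfl
      · exact h.ne rfl⟩⟩

abbrev res (G : SimpleGraph V) (v : V) : SimpleGraph {x // x ≠ v} := G.comap Subtype.val

theorem lft_res {G H : SimpleGraph V} {v : V} (h : ∀ x, G.Adj v x ↔ H.Adj v x) :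
    lft G v (res H v) = H := by
  ext x y
  simp only [lft, res, SimpleGraph.comap_adj]
  by_cases hx : x = v
  · subst hx; simp [h]
  by_cases hy : y = v
  · subst hy
    simp [hx, G.adj_comm x, H.adj_comm x, h]
  simp [hx, hy]

theorem lft_conn {G : SimpleGraph V} {v s : V} (hs : G.Adj v s) {K : SimpleGraph {x // x ≠ v}}
    (hK : K.Connected) : (lft G v K).Connected := by
  have : Nonempty V := ⟨v⟩
  have key : ∀ z, (lft G v K).Reachable s z := by
    intro z
    by_cases hz : z = v
    · subst hz
      exact SimpleGraph.Adj.reachable (Or.inr ⟨hs.symm, Or.inr rfl⟩)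
    · refine reach_ind (hK.preconnected ⟨s, hs.ne.symm⟩ ⟨z, hz⟩)
        (fun z => (lft G v K).Reachable s z) (SimpleGraph.Reachable.refl _) ?_
      intro x y hx hxy
      exact hx.trans (SimpleGraph.Adj.reachable (Or.inl ⟨x.2, y.2, hxy⟩))
  exact ⟨fun x y => (key x).symm.trans (key y)⟩

theorem lft_adj (G : SimpleGraph V) (v : V) (K : SimpleGraph {x // x ≠ v}) (a b : {x // x ≠ v}) :
    (lft G v K).Adj a b ↔ K.Adj a b := by
  simp [lft, a.2, b.2]

theorem lft_cs {G : SimpleGraph V} {v s : V} (hs : G.Adj v s) {K K' : SimpleGraph {x // x ≠ v}}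
    (h : CS K K') : CS (lft G v K) (lft G v K') := by
  obtain ⟨h1, h2, a, b, c, d, hv, rfl⟩ := h
  refine ⟨lft_conn hs h1, lft_conn hs h2, a, b, c, d, ?_, ?_⟩
  · obtain ⟨g1, g2, g3, g4, g5, g6⟩ := hv
    constructor
    · rwa [lft_adj]
    · rwa [lft_adj]
    · rwa [lft_adj]
    · rwa [lft_adj]
    · exact fun h => g5 (Subtype.ext h)
    · exact fun h => g6 (Subtype.ext h)
  · obtain ⟨a, ha⟩ := a
    obtain ⟨b, hb⟩ := b
    obtain ⟨c, hc⟩ := c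
    obtain ⟨d, hd⟩ := d
    ext x y
    have hG : G.Adj x y → x ≠ y := fun h => h.ne
    by_cases hx : x = v
    · simp only [lft, sw]
      grind
    by_cases hy : y = v
    · simp only [lft, sw]
      grind
    simp [lft, sw, hx, hy]

theorem lft_rch {G : SimpleGraph V} {v s : V} (hs : G.Adj v s) {K K' : SimpleGraph {x // x ≠ v}}
    (h : Rch K K') : Rch (lft G v K) (lft G v K') := by
  induction h with
  | refl => exact Relation.ReflTransGen.refl
  | tail _ h1 ih => exact ih.tail (lft_cs hs h1)

theorem res_conn {G : SimpleGraph V} {v p : V} (hp : p ≠ v)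
    (h : ∀ z, z ≠ v → (delV G v).Reachable p z) : (res G v).Connected := by
  have key : ∀ z, (hz : z ≠ v) → (res G v).Reachable ⟨p, hp⟩ ⟨z, hz⟩ := by
    intro z hz
    have : ∃ hz : z ≠ v, (res G v).Reachable ⟨p, hp⟩ ⟨z, hz⟩ := by
      refine reach_ind (h z hz) (fun z => ∃ hz : z ≠ v, (res G v).Reachable ⟨p, hp⟩ ⟨z, hz⟩)
        ⟨hp, SimpleGraph.Reachable.refl _⟩ ?_
      rintro x y ⟨hx, hx'⟩ hxy
      exact ⟨hxy.2.2, hx'.trans (SimpleGraph.Adj.reachable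
        (show (res G v).Adj ⟨x, hx⟩ ⟨y, hxy.2.2⟩ from hxy.1))⟩
    exact this.2
  have : Nonempty {x // x ≠ v} := ⟨⟨p, hp⟩⟩
  exact ⟨fun x y => (key x x.2).symm.trans (key y y.2)⟩

theorem res_dg [Finite V] (G : SimpleGraph V) (v : V) (x : {x // x ≠ v}) :
    dg (res G v) x = (G.neighborSet x \ {v}).ncard := by
  unfold dg
  rw [← Set.ncard_image_of_injective _ Subtype.val_injective]
  congr 1
  ext y
  simp [and_comm]

theorem res_dg_eq [Finite V] {G H : SimpleGraph V} {v : V} (h : ∀ x, G.Adj v x ↔ H.Adj v x)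
    (hdeg : ∀ x, dg G x = dg H x) (x : {x // x ≠ v}) : dg (res G v) x = dg (res H v) x := by
  rw [res_dg, res_dg]
  have e := hdeg x
  unfold dg at e
  have hx := h x
  rw [G.adj_comm, H.adj_comm] at hx
  by_cases hadj : G.Adj x v
  · have e1 := Set.ncard_sdiff_singleton_add_one (a := v) (s := G.neighborSet x) hadj
      (Set.toFinite _)
    have e2 := Set.ncard_sdiff_singleton_add_one (a := v) (s := H.neighborSet x) (hx.1 hadj)
      (Set.toFinite _)
    omega
  · rw [Set.sdiff_singleton_eq_self (s := G.neighborSet x) (fun h => hadj h),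
      Set.sdiff_singleton_eq_self (s := H.neighborSet x) (fun h => hadj (hx.2 h)), e]

end

theorem main_rch : ∀ (n : ℕ) (V : Type*) [Fintype V] (G H : SimpleGraph V), Fintype.card V = n →
    G.Connected → H.Connected → (∀ x, dg G x = dg H x) → Rch G H := by
  intro n
  induction n with
  | zero =>
    intro V _ G H hn hG
    have := hG.nonempty
    exact absurd hn Fintype.card_ne_zero
  | succ n ih =>
    intro V _ G H hn hG hH hdeg
    have hne := hG.nonempty
    obtain ⟨v, hv⟩ := Finite.exists_min (dg G)
    by_cases hp : ∃ p, p ≠ v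
    · obtain ⟨p, hp⟩ := hp
      obtain ⟨G1, H1, hG1, hH1, hN⟩ := make_nbr v _ G H hG hH hdeg rfl
      obtain ⟨G2, hG2, hNG, hcG⟩ := make_conn hp _ G1 (hG1.conn hG)
        (fun x => by rw [hG1.dg_eq, hG1.dg_eq]; exact hv x) rfl
      obtain ⟨H2, hH2, hNH, hcH⟩ := make_conn hp _ H1 (hH1.conn hH)
        (fun x => by rw [hH1.dg_eq, hH1.dg_eq, ← hdeg, ← hdeg]; exact hv x) rfl
      have hN2 : ∀ x, G2.Adj v x ↔ H2.Adj v x := fun x => by rw [hNG, hNH, hN]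
      have hdeg2 : ∀ x, dg G2 x = dg H2 x := fun x => by
        rw [hG2.dg_eq, hG1.dg_eq, hH2.dg_eq, hH1.dg_eq, hdeg]
      have hcard : Fintype.card {x // x ≠ v} = n := by
        rw [Fintype.card_subtype_compl, hn]; simp
      have hR := ih {x // x ≠ v} (res G2 v) (res H2 v) hcard (res_conn hp hcG) (res_conn hp hcH)
        (res_dg_eq hN2 hdeg2)
      obtain ⟨s, hs⟩ : ∃ s, G2.Adj v s := by
        have := (hG2.conn (hG1.conn hG))
        obtain ⟨w⟩ := this.preconnected v p
        cases w with
        | nil => exact absurd rfl hp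
        | cons h _ => exact ⟨_, h⟩
      have hR2 := lft_rch hs hR
      rw [lft_res (fun _ => Iff.rfl), lft_res hN2] at hR2
      exact ((hG1.trans hG2).trans hR2).trans (Rch.symm' (hH1.trans hH2))
    · push Not at hp
      have : G = H := by
        ext x y
        rw [hp x, hp y]
        simp
      rw [this]

theorem cs_switch {V : Type*} [Fintype V] {G G' : SimpleGraph V} (h : CS G G') :
    IsDegreePreservingTwoSwitch G G' := by
  obtain ⟨_, _, a, b, c, d, hv, rfl⟩ := h
  have hne := hv.nes
  obtain ⟨h1, h2, h3, h4, h5, h6⟩ := id hv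
  have hdegs : ∀ v : V, (sw G a b c d).degree v = G.degree v := fun v => by
    rw [← dg_eq_degree, ← dg_eq_degree, hv.dg_eq]
  refine ⟨⟨{s(a, b), s(c, d)}, {s(a, c), s(b, d)}, ?_, ?_, ?_, ?_, ?_⟩, hdegs⟩
  · refine Finset.card_pair ?_
    rw [Ne, Sym2.eq_iff]; grind
  · refine Finset.card_pair ?_
    rw [Ne, Sym2.eq_iff]; grind
  · intro e he
    simp only [Finset.mem_insert, Finset.mem_singleton] at he
    rcases he with rfl | rfl <;> simpa
  · ext e
    induction e using Sym2.ind with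
    | _ x y =>
      have : G.Adj x y → x ≠ y := fun h => h.ne
      simp only [SimpleGraph.mem_edgeFinset, SimpleGraph.mem_edgeSet, Finset.mem_union,
        Finset.mem_sdiff, Finset.mem_insert, Finset.mem_singleton, Sym2.eq_iff]
      simp only [sw]
      clear hdegs hv
      grind
  · have e1 := (sw G a b c d).sum_degrees_eq_twice_card_edges
    have e2 := G.sum_degrees_eq_twice_card_edges
    simp only [hdegs] at e1
    omega

theorem taylor_connected_switch_sequence {V : Type*} [Fintype V]
    (G H : SimpleGraph V) (hG : G.Connected) (hH : H.Connected)
    (hdeg : ∀ v : V, G.degree v = H.degree v) :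
    ∃ (ℓ : ℕ) (f : ℕ → SimpleGraph V),
      f 0 = G ∧ f ℓ = H ∧
      (∀ i ≤ ℓ, (f i).Connected) ∧
      (∀ i < ℓ, IsDegreePreservingTwoSwitch (f i) (f (i + 1))) := by
  have hR : Rch G H := main_rch _ V G H rfl hG hH
    (fun x => by rw [dg_eq_degree, dg_eq_degree]; exact hdeg x)
  clear hdeg hH
  induction hR with
  | refl => exact ⟨0, fun _ => G, rfl, rfl, fun _ _ => hG, fun i hi => absurd hi (by omega)⟩
  | @tail K K' _ h ih =>
    obtain ⟨l, f, h0, hl, hc, hs⟩ := ih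
    refine ⟨l + 1, fun i => if i ≤ l then f i else K', by simp [h0], by simp, ?_, ?_⟩
    · intro i _
      dsimp only
      split_ifs with hi
      · exact hc i hi
      · exact h.2.1
    · intro i hi
      dsimp only
      rw [if_pos (by omega : i ≤ l)]
      split_ifs with hi2
      · exact hs i (by omega)
      · have : i = l := by omega
        subst this
        rw [hl]
        exact cs_switch h
end
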